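/- If the finite-dimensional real Lie algebra g = (V,μ) contracts onto g' = (V,μ'), then for every k ≥ 0 one has dim H^k(g,g) ≤ dim H^k(g',g'), where H^k(g,g) denotes Chevalley–Eilenberg cohomology with coefficients in the adjoint module. -/

import Mathlib

open Filter Topology Set

/-- A Lie bracket on a real vector space `V`: a bilinear alternating map satisfying
the Jacobi identity. -/
structure LieBracketOn (V : Type) [AddCommGroup V] [Module ℝ V] : Type where
  br : V →ₗ[ℝ] V →ₗ[ℝ] V
  alt : ∀ x : V, br x x = 0
  jacobi : ∀ x y z : V, br x (br y z) + br y (br z x) + br z (br x y) = 0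

variable {V : Type} [NormedAddCommGroup V] [NormedSpace ℝ V]

/-- `g = (V,μ)` contracts onto `g' = (V,μ')`: there is a family `Φ_t` of linear
automorphisms of `V` such that `Φ_t⁻¹ (μ (Φ_t X) (Φ_t Y)) → μ' X Y` as `t → ∞`. -/
def Contracts (μ μ' : LieBracketOn V) : Prop :=
  ∃ Φ : ℝ → (V ≃ₗ[ℝ] V), ∀ X Y : V,
    Tendsto (fun t : ℝ => (Φ t).symm (μ.br (Φ t X) (Φ t Y))) atTop (𝓝 (μ'.br X Y))

/-- `(V,μ)` and `(V,μ')` are isomorphic as Lie algebras. -/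
def BrIso (μ μ' : LieBracketOn V) : Prop :=
  ∃ e : V ≃ₗ[ℝ] V, ∀ x y : V, e (μ.br x y) = μ'.br (e x) (e y)

/-- `μt` is a deformation of plateau type from `g' = (V,μ')` to `g = (V,μ)`:
`t ↦ μ_t(X,Y)` is continuous on `[0,1]`, `μ_0 = μ'`, `(V,μ_t) ≃ (V,μ)` for all
`t ∈ (0,1]`, and `(V,μ') ≄ (V,μ)`. -/
def IsPlateauDeformation (μ' μ : LieBracketOn V) (μt : ℝ → LieBracketOn V) : Prop :=
  (∀ X Y : V, ContinuousOn (fun t => (μt t).br X Y) (Icc (0:ℝ) 1)) ∧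
  μt 0 = μ' ∧ (∀ t ∈ Ioc (0:ℝ) 1, BrIso (μt t) μ) ∧ ¬ BrIso μ' μ

open Filter Topology Set

namespace CE

variable {V W : Type} [AddCommGroup V] [Module ℝ V] [AddCommGroup W] [Module ℝ W]

/-- The Chevalley–Eilenberg coboundary of a `p`-cochain `Φ` (an alternating `p`-linear
map `V^p → W`), relative to a bracket `br` on `V` and an action `ρ` of `V` on `W`,
evaluated on a `(p+1)`-tuple `X` (indices `0,…,p` correspond to `X_1,…,X_{p+1}`):
`dΦ(X_0,…,X_p) = Σ_s (−1)^s ρ(X_s)(Φ(…,X̂_s,…))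
  + Σ_{s<t} (−1)^{s+t} Φ(br(X_s,X_t),…,X̂_s,…,X̂_t,…)`. -/
def ceDfun (br : V →ₗ[ℝ] V →ₗ[ℝ] V) (ρ : V →ₗ[ℝ] W →ₗ[ℝ] W) {p : ℕ}
    (Φ : V [⋀^Fin p]→ₗ[ℝ] W) (X : Fin (p + 1) → V) : W :=
  (∑ s : Fin (p + 1), ((-1 : ℝ) ^ (s : ℕ)) • ρ (X s) (Φ (X ∘ s.succAbove)))
  + ∑ s : Fin (p + 1), ∑ t : Fin (p + 1),
      if (s : ℕ) < (t : ℕ) then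
        ((-1 : ℝ) ^ ((s : ℕ) + (t : ℕ))) • Φ (fun i : Fin p =>
          if (i : ℕ) = 0 then br (X s) (X t)
          else if (i : ℕ) - 1 < (s : ℕ) then X ⟨(i : ℕ) - 1, by have := i.isLt; omega⟩
          else if (i : ℕ) < (t : ℕ) then X ⟨(i : ℕ), by have := i.isLt; omega⟩
          else X ⟨(i : ℕ) + 1, by have := i.isLt; omega⟩)
      else 0

/-- The Chevalley–Eilenberg coboundary, as a linear map into functions. -/
def ceD (br : V →ₗ[ℝ] V →ₗ[ℝ] V) (ρ : V →ₗ[ℝ] W →ₗ[ℝ] W) (p : ℕ) :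
    (V [⋀^Fin p]→ₗ[ℝ] W) →ₗ[ℝ] ((Fin (p + 1) → V) → W) where
  toFun Φ := ceDfun br ρ Φ
  map_add' Φ Ψ := by
    have key : ∀ {c : Prop} [Decidable c] (a b : W),
        (if c then a + b else 0) = (if c then a else 0) + (if c then b else 0) := by
      intro c _ a b; split <;> simp
    funext X
    simp only [ceDfun, AlternatingMap.add_apply, map_add, smul_add, Pi.add_apply,
      key, Finset.sum_add_distrib]
    abel
  map_smul' c Φ := by
    funext X
    simp only [ceDfun, AlternatingMap.smul_apply, map_smul, RingHom.id_apply, Pi.smul_apply,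
      smul_add, Finset.smul_sum, smul_ite, smul_zero, smul_smul, mul_comm]

/-- Evaluation of an alternating map as a plain function, as a linear map. -/
def altEval (q : ℕ) : (V [⋀^Fin q]→ₗ[ℝ] W) →ₗ[ℝ] ((Fin q → V) → W) where
  toFun Ψ := ⇑Ψ
  map_add' a b := by funext X; simp
  map_smul' c a := by funext X; simp

/-- The space `Z^p` of `p`-cocycles. -/
def ceZ (br : V →ₗ[ℝ] V →ₗ[ℝ] V) (ρ : V →ₗ[ℝ] W →ₗ[ℝ] W) (p : ℕ) :
    Submodule ℝ (V [⋀^Fin p]→ₗ[ℝ] W) :=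
  LinearMap.ker (ceD br ρ p)

/-- The space `B^p` of `p`-coboundaries (`B^0 = 0`). -/
def ceB (br : V →ₗ[ℝ] V →ₗ[ℝ] V) (ρ : V →ₗ[ℝ] W →ₗ[ℝ] W) :
    (p : ℕ) → Submodule ℝ (V [⋀^Fin p]→ₗ[ℝ] W)
  | 0 => ⊥
  | (p + 1) => Submodule.comap (altEval (p + 1)) (LinearMap.range (ceD br ρ p))

/-- The `p`-th Chevalley–Eilenberg cohomology space `H^p = Z^p / B^p`. -/
def CEH (br : V →ₗ[ℝ] V →ₗ[ℝ] V) (ρ : V →ₗ[ℝ] W →ₗ[ℝ] W) (p : ℕ) : Type :=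
  ceZ br ρ p ⧸ Submodule.comap (ceZ br ρ p).subtype (ceB br ρ p)

noncomputable instance (br : V →ₗ[ℝ] V →ₗ[ℝ] V) (ρ : V →ₗ[ℝ] W →ₗ[ℝ] W) (p : ℕ) :
    AddCommGroup (CEH br ρ p) :=
  inferInstanceAs (AddCommGroup (ceZ br ρ p ⧸ Submodule.comap (ceZ br ρ p).subtype (ceB br ρ p)))

noncomputable instance (br : V →ₗ[ℝ] V →ₗ[ℝ] V) (ρ : V →ₗ[ℝ] W →ₗ[ℝ] W) (p : ℕ) :
    Module ℝ (CEH br ρ p) :=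
  inferInstanceAs (Module ℝ (ceZ br ρ p ⧸ Submodule.comap (ceZ br ρ p).subtype (ceB br ρ p)))

/-- `dim H^p`. -/
noncomputable def Hdim (br : V →ₗ[ℝ] V →ₗ[ℝ] V) (ρ : V →ₗ[ℝ] W →ₗ[ℝ] W) (p : ℕ) : ℕ :=
  Module.finrank ℝ (CEH br ρ p)

end CE

namespace CE

variable {V W : Type} [AddCommGroup V] [Module ℝ V] [AddCommGroup W] [Module ℝ W]

theorem update_id_apply {p : ℕ} (A : V →ₗ[ℝ] V) (i : Fin p) (Y : Fin p → V) :
    (fun j => (Function.update (fun _ => LinearMap.id) i A : Fin p → V →ₗ[ℝ] V) j (Y j)) =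
      Function.update Y i (A (Y i)) := by
  funext j
  rcases eq_or_ne j i with rfl | h
  · simp
  · simp [h]

/-- The substitution of `A (Y i)` for `Y i`, summed over all arguments of an alternating map. -/
def derivationAction {p : ℕ} (A : V →ₗ[ℝ] V) (Φ : V [⋀^Fin p]→ₗ[ℝ] W) : V [⋀^Fin p]→ₗ[ℝ] W :=
  { ∑ i : Fin p, Φ.toMultilinearMap.compLinearMap (Function.update (fun _ => LinearMap.id) i A) with
    map_eq_zero_of_eq' := by
      intro v i j hv hij
      change (∑ i : Fin p, Φ.toMultilinearMap.compLinearMap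
        (Function.update (fun _ => LinearMap.id) i A)) v = 0
      simp only [sum_apply, MultilinearMap.compLinearMap_apply, update_id_apply]
      rw [Finset.sum_eq_add i j hij ?_ (by simp) (by simp)]
      · have : Function.update v j (A (v j)) =
            Function.update v i (A (v i)) ∘ Equiv.swap i j := by
          funext m
          rcases eq_or_ne m i with rfl | hi
          · simp [hij, hij.symm, hv]
          · rcases eq_or_ne m j with rfl | hj
            · simp [hv]
            · simp [hi, hj, Equiv.swap_apply_of_ne_of_ne]
        rw [this]
        exact Φ.map_add_swap _ hij
      · intro l _ hl
        exact Φ.map_eq_zero_of_eq _ (by simp [hl.1.symm, hl.2.symm, hv]) hij }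

theorem derivationAction_apply {p : ℕ} (A : V →ₗ[ℝ] V) (Φ : V [⋀^Fin p]→ₗ[ℝ] W) (Y : Fin p → V) :
    derivationAction A Φ Y = ∑ i, Φ (Function.update Y i (A (Y i))) := by
  change (∑ i : Fin p, Φ.toMultilinearMap.compLinearMap
    (Function.update (fun _ => LinearMap.id) i A)) Y = _
  simp only [sum_apply, MultilinearMap.compLinearMap_apply, update_id_apply]
  rfl

/-- The Lie derivative `L_x Φ` of a cochain along `x`. -/
def lieDeriv (br : V →ₗ[ℝ] V →ₗ[ℝ] V) (ρ : V →ₗ[ℝ] W →ₗ[ℝ] W) {p : ℕ} (x : V)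
    (Φ : V [⋀^Fin p]→ₗ[ℝ] W) : V [⋀^Fin p]→ₗ[ℝ] W :=
  (ρ x).compAlternatingMap Φ - derivationAction (br x) Φ

section

variable (br : V →ₗ[ℝ] V →ₗ[ℝ] V) (ρ : V →ₗ[ℝ] W →ₗ[ℝ] W) {p : ℕ}

theorem lieDeriv_apply (x : V) (Φ : V [⋀^Fin p]→ₗ[ℝ] W) (Y : Fin p → V) :
    lieDeriv br ρ x Φ Y = ρ x (Φ Y) - ∑ i, Φ (Function.update Y i (br x (Y i))) := by
  simp [lieDeriv, derivationAction_apply]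

theorem lieDeriv_add_left (x y : V) (Φ : V [⋀^Fin p]→ₗ[ℝ] W) :
    lieDeriv br ρ (x + y) Φ = lieDeriv br ρ x Φ + lieDeriv br ρ y Φ := by
  ext Y
  simp only [lieDeriv_apply, AlternatingMap.add_apply, map_add, LinearMap.add_apply,
    AlternatingMap.map_update_add, Finset.sum_add_distrib]
  abel

theorem lieDeriv_smul_left (c : ℝ) (x : V) (Φ : V [⋀^Fin p]→ₗ[ℝ] W) :
    lieDeriv br ρ (c • x) Φ = c • lieDeriv br ρ x Φ := by
  ext Y
  simp only [lieDeriv_apply, AlternatingMap.smul_apply, map_smul, LinearMap.smul_apply,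
    AlternatingMap.map_update_smul, ← Finset.smul_sum, smul_sub]

theorem lieDeriv_sub (x : V) (Φ Ψ : V [⋀^Fin p]→ₗ[ℝ] W) :
    lieDeriv br ρ x (Φ - Ψ) = lieDeriv br ρ x Φ - lieDeriv br ρ x Ψ := by
  ext Y
  simp only [lieDeriv_apply, AlternatingMap.sub_apply, map_sub, Finset.sum_sub_distrib]
  abel

theorem curryLeft_lieDeriv (x y : V) (Φ : V [⋀^Fin (p + 1)]→ₗ[ℝ] W) :
    (lieDeriv br ρ x Φ).curryLeft y =
      lieDeriv br ρ x (Φ.curryLeft y) - Φ.curryLeft (br x y) := by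
  ext Y
  simp only [lieDeriv_apply, AlternatingMap.curryLeft_apply_apply, AlternatingMap.sub_apply,
    Fin.sum_univ_succ, Matrix.vecCons, Fin.cons_zero, Fin.cons_succ, Fin.update_cons_zero,
    Fin.cons_update]
  abel

theorem ext_curryLeft {Φ Ψ : V [⋀^Fin (p + 1)]→ₗ[ℝ] W}
    (h : ∀ x, Φ.curryLeft x = Ψ.curryLeft x) : Φ = Ψ := by
  ext Y
  have := DFunLike.congr_fun (h (Y 0)) (Fin.tail Y)
  simpa [Matrix.vecCons] using this

theorem lieDeriv_br (hρ : ∀ x y w, ρ (br x y) w = ρ x (ρ y w) - ρ y (ρ x w))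
    (hbr : ∀ x y z, br (br x y) z = br x (br y z) - br y (br x z)) (x y : V) :
    ∀ {p : ℕ} (Φ : V [⋀^Fin p]→ₗ[ℝ] W), lieDeriv br ρ (br x y) Φ =
      lieDeriv br ρ x (lieDeriv br ρ y Φ) - lieDeriv br ρ y (lieDeriv br ρ x Φ)
  | 0, Φ => by
    ext Y
    simp [lieDeriv_apply, hρ]
  | p + 1, Φ => by
    apply ext_curryLeft
    intro z
    have key : ∀ a b : V [⋀^Fin (p + 1)]→ₗ[ℝ] W,
        (a - b).curryLeft z = a.curryLeft z - b.curryLeft z := fun _ _ => rfl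
    simp only [key, curryLeft_lieDeriv, lieDeriv_sub, lieDeriv_br hρ hbr x y (Φ.curryLeft z),
      hbr, map_sub]
    abel

theorem ceDfun_zero (Φ : V [⋀^Fin 0]→ₗ[ℝ] W) (x : V) (Y : Fin 0 → V) :
    ceDfun br ρ Φ (Fin.cons x Y) = lieDeriv br ρ x Φ Y := by
  simp [ceDfun, lieDeriv_apply, Subsingleton.elim (_ ∘ _ : Fin 0 → V) Y]

theorem map_cons_removeNth (Φ : V [⋀^Fin (p + 1)]→ₗ[ℝ] W) (a : V) (t : Fin (p + 1))
    (Y : Fin (p + 1) → V) :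
    Φ (Fin.cons a (t.removeNth Y)) = (-1 : ℝ) ^ (t : ℕ) • Φ (Function.update Y t a) := by
  have h := Φ.neg_one_pow_smul_map_insertNth t a (t.removeNth Y)
  rw [Fin.insertNth_removeNth] at h
  change _ = Φ (Fin.cons a (t.removeNth Y)) at h
  rw [← h, ← Int.cast_smul_eq_zsmul ℝ]
  push_cast
  rfl

theorem ceDfun_cons (Φ : V [⋀^Fin (p + 1)]→ₗ[ℝ] W) (x : V) (Y : Fin (p + 1) → V) :
    ceDfun br ρ Φ (Fin.cons x Y) =
      lieDeriv br ρ x Φ Y - ceDfun br ρ (Φ.curryLeft x) Y := by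
  simp only [ceDfun, lieDeriv_apply]
  have h1 : ∑ s : Fin (p + 1 + 1), ((-1 : ℝ) ^ (s : ℕ)) •
      ρ ((Fin.cons x Y : Fin (p + 2) → V) s) (Φ ((Fin.cons x Y : Fin (p + 2) → V) ∘ s.succAbove)) =
      ρ x (Φ Y) - ∑ s : Fin (p + 1), ((-1 : ℝ) ^ (s : ℕ)) •
        ρ (Y s) (Φ.curryLeft x (Y ∘ s.succAbove)) := by
    rw [Fin.sum_univ_succ, sub_eq_add_neg, ← Finset.sum_neg_distrib]
    congr 1
    · simp [Function.comp_def]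
    · refine Finset.sum_congr rfl fun s _ => ?_
      have : (Fin.cons x Y : Fin (p + 2) → V) ∘ s.succ.succAbove =
          Matrix.vecCons x (Y ∘ s.succAbove) := by
        funext i
        refine Fin.cases ?_ (fun i => ?_) i <;> simp
      simp [this, pow_succ]
  rw [h1]
  have hs : ∀ a b c d e : W, c = -b - e → a - d + c = a - b - (d + e) := by
    intro a b c d e h
    rw [h]; abel
  apply hs
  rw [Fin.sum_univ_succ, sub_eq_add_neg, ← Finset.sum_neg_distrib, ← Finset.sum_neg_distrib]
  congr 1
  · rw [Fin.sum_univ_succ, if_neg (by simp), zero_add]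
    refine Finset.sum_congr rfl fun t _ => ?_
    rw [if_pos (by simp)]
    have key : ∀ F : Fin (p + 1) → V, F = Fin.cons (br x (Y t)) (t.removeNth Y) →
        (-1 : ℝ) ^ (t + 1 : ℕ) • Φ F = -Φ (Function.update Y t (br x (Y t))) := by
      rintro F rfl
      rw [map_cons_removeNth, smul_smul, ← pow_add, show (t : ℕ) + 1 + t = 2 * t + 1 by ring]
      simp [pow_succ, pow_mul]
    simp only [Fin.val_zero, Fin.val_succ, Fin.cons_zero, Fin.cons_succ, zero_add]
    apply key
    funext i
    refine Fin.cases (by simp) (fun i => ?_) i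
    have e1 : (⟨(i : ℕ) + 1, by have := i.isLt; omega⟩ : Fin (p + 2)) = Fin.succ i.castSucc := by
      ext; simp
    have e2 : (⟨(i : ℕ) + 1 + 1, by have := i.isLt; omega⟩ : Fin (p + 2)) = Fin.succ i.succ := by
      ext; simp
    simp only [Fin.val_succ, Nat.add_one_ne_zero, if_false, add_tsub_cancel_right, Nat.not_lt_zero,
      add_lt_add_iff_right, e1, e2, Fin.cons_succ, Fin.removeNth]
    split_ifs with h
    · rw [Fin.succAbove_of_castSucc_lt _ _ (by simpa [Fin.lt_def] using h)]
    · rw [Fin.succAbove_of_le_castSucc _ _ (by simpa [Fin.le_def] using h)]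
  · refine Finset.sum_congr rfl fun s _ => ?_
    rw [Fin.sum_univ_succ, if_neg (by simp), zero_add, ← Finset.sum_neg_distrib]
    refine Finset.sum_congr rfl fun t _ => ?_
    simp only [Fin.val_succ, add_lt_add_iff_right]
    split_ifs with hst
    swap
    · simp
    have hp : 1 < p + 1 := by have := t.isLt; omega
    have key := Φ.map_swap (Matrix.vecCons x (fun i : Fin p =>
          if (i : ℕ) = 0 then br (Y s) (Y t)
          else if (i : ℕ) - 1 < (s : ℕ) then Y ⟨(i : ℕ) - 1, by have := i.isLt; omega⟩
          else if (i : ℕ) < (t : ℕ) then Y ⟨(i : ℕ), by have := i.isLt; omega⟩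
          else Y ⟨(i : ℕ) + 1, by have := i.isLt; omega⟩))
          (i := 0) (j := ⟨1, hp⟩) (by simp [Fin.ext_iff])
    rw [AlternatingMap.curryLeft_apply_apply, ← smul_neg, ← key]
    rw [show (s : ℕ) + 1 + (t + 1) = s + t + 2 by ring, pow_add, neg_one_sq, mul_one]
    congr 2
    funext i
    obtain ⟨i, hi⟩ := i
    rcases i with _ | _ | i
    · have e : (Equiv.swap (0 : Fin (p + 1)) ⟨1, hp⟩) ⟨0, hi⟩ = Fin.succ ⟨0, by omega⟩ :=
        Equiv.swap_apply_left _ _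
      simp only [Function.comp_apply, e, Matrix.vecCons, Fin.cons_succ, if_true]
    · simp [Matrix.vecCons]
    · have e : (Equiv.swap (0 : Fin (p + 1)) ⟨1, hp⟩) ⟨i + 1 + 1, hi⟩ =
          Fin.succ ⟨i + 1, by omega⟩ := by
        rw [Equiv.swap_apply_of_ne_of_ne] <;> simp [Fin.ext_iff]
      simp only [Function.comp_apply, e, Matrix.vecCons, Fin.cons_succ]
      split_ifs <;> first | rfl | omega

theorem ceDfun_add (Φ Ψ : V [⋀^Fin p]→ₗ[ℝ] W) (X : Fin (p + 1) → V) :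
    ceDfun br ρ (Φ + Ψ) X = ceDfun br ρ Φ X + ceDfun br ρ Ψ X :=
  congrFun (map_add (ceD br ρ p) Φ Ψ) X

theorem ceDfun_smul (c : ℝ) (Φ : V [⋀^Fin p]→ₗ[ℝ] W) (X : Fin (p + 1) → V) :
    ceDfun br ρ (c • Φ) X = c • ceDfun br ρ Φ X :=
  congrFun (map_smul (ceD br ρ p) c Φ) X

/-- The coboundary of an alternating cochain is alternating. -/
theorem exists_alternating_eq_ceDfun (halt : ∀ x, br x x = 0) :
    ∀ {p : ℕ} (Φ : V [⋀^Fin p]→ₗ[ℝ] W), ∃ Ψ : V [⋀^Fin (p + 1)]→ₗ[ℝ] W, ⇑Ψ = ceDfun br ρ Φ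
  | 0, Φ => by
    refine ⟨AlternatingMap.ofSubsingleton ℝ V W (0 : Fin 1) (ρ.flip (Φ Fin.elim0)), ?_⟩
    funext X
    rw [← Fin.cons_self_tail X, ceDfun_zero]
    simp [lieDeriv_apply, Subsingleton.elim (Fin.elim0 : Fin 0 → V) (Fin.tail X)]
  | p + 1, Φ => by
    choose d hd using fun Φ => exists_alternating_eq_ceDfun halt (p := p) Φ
    let f : V →ₗ[ℝ] MultilinearMap ℝ (fun _ : Fin (p + 1) => V) W :=
      { toFun := fun x => (lieDeriv br ρ x Φ - d (Φ.curryLeft x)).toMultilinearMap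
        map_add' := fun x y => by
          ext Y
          simp only [AlternatingMap.coe_multilinearMap, AlternatingMap.sub_apply, hd, map_add,
            lieDeriv_add_left, AlternatingMap.add_apply, add_apply, ceDfun_add]
          abel
        map_smul' := fun c x => by
          ext Y
          simp only [AlternatingMap.coe_multilinearMap, AlternatingMap.sub_apply, hd, map_smul,
            lieDeriv_smul_left, AlternatingMap.smul_apply, smul_apply, ceDfun_smul,
            smul_sub, RingHom.id_apply] }
    have hf : ∀ x Y, f x Y = (lieDeriv br ρ x Φ - d (Φ.curryLeft x)) Y := fun _ _ => rfl
    let g := LinearMap.uncurryLeft (R := ℝ) (M := fun _ : Fin (p + 2) => V) (M₂ := W) f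
    have hg : ∀ v, g v = f (v 0) (Fin.tail v) := fun _ => rfl
    have hfD : ⇑g = ceDfun br ρ Φ := by
      funext X
      rw [← Fin.cons_self_tail X, ceDfun_cons, ← hd, hg, hf]
      simp
    have hcons : ∀ x (Z : Fin p → V), f x (Fin.cons x Z) = 0 := by
      intro x Z
      rw [hf]
      have h1 := DFunLike.congr_fun (curryLeft_lieDeriv br ρ x x Φ) Z
      rw [halt, map_zero, sub_zero] at h1
      simp only [AlternatingMap.curryLeft_apply_apply, Matrix.vecCons] at h1
      rw [AlternatingMap.sub_apply, hd, h1]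
      rcases p with _ | p
      · rw [ceDfun_zero, sub_self]
      · rw [ceDfun_cons, AlternatingMap.curryLeft_same]
        have h0 := congrFun (map_zero (ceD br ρ p)) Z
        change ceDfun br ρ 0 Z = 0 at h0
        rw [h0]
        simp
    refine ⟨{ g with map_eq_zero_of_eq' := ?_ }, hfD⟩
    intro v i j hv hij
    change g v = 0
    rw [hg]
    have hzero : ∀ j : Fin (p + 1), v 0 = v j.succ → f (v 0) (Fin.tail v) = 0 := by
      intro j h0
      rw [hf, ← Fin.insertNth_self_removeNth j (Fin.tail v), AlternatingMap.map_insertNth]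
      change _ • (lieDeriv br ρ (v 0) Φ - d (Φ.curryLeft (v 0))) (Fin.cons (v j.succ) _) = 0
      rw [← h0, ← hf, hcons, smul_zero]
    rcases Fin.eq_zero_or_eq_succ i with rfl | ⟨i, rfl⟩
    · rcases Fin.eq_zero_or_eq_succ j with rfl | ⟨j, rfl⟩
      · exact absurd rfl hij
      · exact hzero j hv
    · rcases Fin.eq_zero_or_eq_succ j with rfl | ⟨j, rfl⟩
      · exact hzero i hv.symm
      · rw [hf]
        exact AlternatingMap.map_eq_zero_of_eq _ (Fin.tail v) hv (by simpa using hij)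

/-- The Chevalley–Eilenberg coboundary with values in alternating cochains. -/
noncomputable def ceDAlt (halt : ∀ x, br x x = 0) (p : ℕ) :
    (V [⋀^Fin p]→ₗ[ℝ] W) →ₗ[ℝ] (V [⋀^Fin (p + 1)]→ₗ[ℝ] W) where
  toFun Φ := (exists_alternating_eq_ceDfun br ρ halt Φ).choose
  map_add' Φ Ψ := by
    ext X
    simp only [(exists_alternating_eq_ceDfun br ρ halt _).choose_spec, AlternatingMap.add_apply,
      ceDfun_add]
  map_smul' c Φ := by
    ext X
    simp only [(exists_alternating_eq_ceDfun br ρ halt _).choose_spec, AlternatingMap.smul_apply,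
      ceDfun_smul, RingHom.id_apply]

variable (halt : ∀ x, br x x = 0)

theorem ceDAlt_apply (Φ : V [⋀^Fin p]→ₗ[ℝ] W) (X : Fin (p + 1) → V) :
    ceDAlt br ρ halt p Φ X = ceDfun br ρ Φ X :=
  congrFun (exists_alternating_eq_ceDfun br ρ halt Φ).choose_spec X

theorem curryLeft_ceDAlt_zero (Φ : V [⋀^Fin 0]→ₗ[ℝ] W) (x : V) :
    (ceDAlt br ρ halt 0 Φ).curryLeft x = lieDeriv br ρ x Φ := by
  ext Y
  rw [AlternatingMap.curryLeft_apply_apply, ceDAlt_apply, Matrix.vecCons, ceDfun_zero]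

/-- Cartan's formula. -/
theorem curryLeft_ceDAlt_succ (Φ : V [⋀^Fin (p + 1)]→ₗ[ℝ] W) (x : V) :
    (ceDAlt br ρ halt (p + 1) Φ).curryLeft x =
      lieDeriv br ρ x Φ - ceDAlt br ρ halt p (Φ.curryLeft x) := by
  ext Y
  rw [AlternatingMap.curryLeft_apply_apply, ceDAlt_apply, Matrix.vecCons, ceDfun_cons,
    AlternatingMap.sub_apply, ceDAlt_apply]

theorem lieDeriv_ceDAlt (hρ : ∀ x y w, ρ (br x y) w = ρ x (ρ y w) - ρ y (ρ x w))
    (hbr : ∀ x y z, br (br x y) z = br x (br y z) - br y (br x z)) (x : V) :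
    ∀ {p : ℕ} (Φ : V [⋀^Fin p]→ₗ[ℝ] W),
      lieDeriv br ρ x (ceDAlt br ρ halt p Φ) = ceDAlt br ρ halt p (lieDeriv br ρ x Φ)
  | 0, Φ => by
    apply ext_curryLeft
    intro y
    rw [curryLeft_lieDeriv, curryLeft_ceDAlt_zero, curryLeft_ceDAlt_zero, curryLeft_ceDAlt_zero,
      lieDeriv_br br ρ hρ hbr]
    abel
  | p + 1, Φ => by
    apply ext_curryLeft
    intro y
    rw [curryLeft_lieDeriv, curryLeft_ceDAlt_succ, curryLeft_ceDAlt_succ, curryLeft_ceDAlt_succ,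
      curryLeft_lieDeriv, lieDeriv_br br ρ hρ hbr, lieDeriv_sub, map_sub,
      lieDeriv_ceDAlt hρ hbr x (Φ.curryLeft y)]
    abel

theorem ceDAlt_ceDAlt (hρ : ∀ x y w, ρ (br x y) w = ρ x (ρ y w) - ρ y (ρ x w))
    (hbr : ∀ x y z, br (br x y) z = br x (br y z) - br y (br x z)) :
    ∀ {p : ℕ} (Φ : V [⋀^Fin p]→ₗ[ℝ] W),
      ceDAlt br ρ halt (p + 1) (ceDAlt br ρ halt p Φ) = 0
  | 0, Φ => by
    apply ext_curryLeft
    intro y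
    rw [curryLeft_ceDAlt_succ, curryLeft_ceDAlt_zero, lieDeriv_ceDAlt br ρ halt hρ hbr, sub_self]
    rfl
  | p + 1, Φ => by
    apply ext_curryLeft
    intro y
    rw [curryLeft_ceDAlt_succ, curryLeft_ceDAlt_succ, lieDeriv_ceDAlt br ρ halt hρ hbr, map_sub,
      ceDAlt_ceDAlt hρ hbr (Φ.curryLeft y), sub_zero, sub_self]
    rfl

end

end CE

/-- Lower semicontinuity of the rank under pointwise limits of linear maps. -/
theorem eventually_finrank_range_le {ι C E : Type*} [AddCommGroup C] [Module ℝ C]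
    [NormedAddCommGroup E] [NormedSpace ℝ E] [FiniteDimensional ℝ E] {l : Filter ι}
    {T : ι → C →ₗ[ℝ] E} {T' : C →ₗ[ℝ] E} (h : ∀ c, Tendsto (fun t => T t c) l (𝓝 (T' c))) :
    ∀ᶠ t in l,
      Module.finrank ℝ (LinearMap.range T') ≤ Module.finrank ℝ (LinearMap.range (T t)) := by
  let b := Module.finBasis ℝ (LinearMap.range T')
  choose c hc using fun i => (b i).2
  have hli : LinearIndependent ℝ (fun i => T' (c i)) := by
    simp_rw [hc]
    exact b.linearIndependent.map' (LinearMap.range T').subtype (Submodule.ker_subtype _)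
  have hlim : Tendsto (fun t i => T t (c i)) l (𝓝 fun i => T' (c i)) :=
    tendsto_pi_nhds.2 fun i => h (c i)
  filter_upwards [hlim.eventually hli.eventually] with t ht
  have : LinearIndependent ℝ
      (fun i => (⟨T t (c i), LinearMap.mem_range_self _ _⟩ : LinearMap.range (T t))) :=
    LinearIndependent.of_comp (LinearMap.range (T t)).subtype ht
  simpa using this.fintype_card_le_finrank

namespace CE

theorem finrank_range_comp_le {A B C : Type*} [AddCommGroup A] [Module ℝ A] [AddCommGroup B]
    [Module ℝ B] [AddCommGroup C] [Module ℝ C] [FiniteDimensional ℝ A]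
    (g : B →ₗ[ℝ] C) (f : A →ₗ[ℝ] B) :
    Module.finrank ℝ (LinearMap.range (g ∘ₗ f)) ≤ Module.finrank ℝ (LinearMap.range f) := by
  rw [LinearMap.range_comp]
  exact Submodule.finrank_map_le g _

section Dimension

variable {V W : Type} [AddCommGroup V] [Module ℝ V] [AddCommGroup W] [Module ℝ W]

instance finiteDimensional_alternatingMap [FiniteDimensional ℝ V] [FiniteDimensional ℝ W] (p : ℕ) :
    FiniteDimensional ℝ (V [⋀^Fin p]→ₗ[ℝ] W) :=
  FiniteDimensional.of_injective
    (AlternatingMap.toMultilinearMapLM (S := ℝ) : (V [⋀^Fin p]→ₗ[ℝ] W) →ₗ[ℝ] _)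
    AlternatingMap.coe_multilinearMap_injective

variable (br : V →ₗ[ℝ] V →ₗ[ℝ] V) (ρ : V →ₗ[ℝ] W →ₗ[ℝ] W) (halt : ∀ x, br x x = 0) (p : ℕ)

theorem altEval_injective : Function.Injective (altEval p : (V [⋀^Fin p]→ₗ[ℝ] W) →ₗ[ℝ] _) :=
  DFunLike.coe_injective

theorem ceD_eq_altEval_comp : ceD br ρ p = altEval (p + 1) ∘ₗ ceDAlt br ρ halt p := by
  ext Φ X
  exact (ceDAlt_apply br ρ halt Φ X).symm

theorem ceB_succ : ceB br ρ (p + 1) = LinearMap.range (ceDAlt br ρ halt p) := by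
  rw [ceB, ceD_eq_altEval_comp br ρ halt, LinearMap.range_comp,
    Submodule.comap_map_eq_of_injective (altEval_injective _)]

variable [FiniteDimensional ℝ V] [FiniteDimensional ℝ W]

theorem Hdim_zero_add : Hdim br ρ 0 + Module.finrank ℝ (LinearMap.range (ceD br ρ 0)) =
    Module.finrank ℝ (V [⋀^Fin 0]→ₗ[ℝ] W) := by
  have h1 := (ceD br ρ 0).finrank_range_add_finrank_ker
  have h2 := (Submodule.comap (ceZ br ρ 0).subtype (ceB br ρ 0)).finrank_quotient_add_finrank
  have h3 : Submodule.comap (ceZ br ρ 0).subtype (ceB br ρ 0) = ⊥ := by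
    rw [ceB, Submodule.comap_bot, Submodule.ker_subtype]
  change Hdim br ρ 0 + _ = _ at h2
  rw [h3, finrank_bot] at h2
  change _ + Module.finrank ℝ (ceZ br ρ 0) = _ at h1
  omega

theorem Hdim_succ_add (halt : ∀ x, br x x = 0)
    (hρ : ∀ x y w, ρ (br x y) w = ρ x (ρ y w) - ρ y (ρ x w))
    (hbr : ∀ x y z, br (br x y) z = br x (br y z) - br y (br x z)) :
    Hdim br ρ (p + 1) + Module.finrank ℝ (LinearMap.range (ceD br ρ p)) +
      Module.finrank ℝ (LinearMap.range (ceD br ρ (p + 1))) =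
    Module.finrank ℝ (V [⋀^Fin (p + 1)]→ₗ[ℝ] W) := by
  have h1 := (ceD br ρ (p + 1)).finrank_range_add_finrank_ker
  have h2 := (Submodule.comap (ceZ br ρ (p + 1)).subtype
    (ceB br ρ (p + 1))).finrank_quotient_add_finrank
  change Hdim br ρ (p + 1) + _ = _ at h2
  change _ + Module.finrank ℝ (ceZ br ρ (p + 1)) = _ at h1
  have hle : ceB br ρ (p + 1) ≤ ceZ br ρ (p + 1) := by
    rw [ceB_succ br ρ halt]
    rintro _ ⟨Φ, rfl⟩
    rw [ceZ, LinearMap.mem_ker, ceD_eq_altEval_comp br ρ halt, LinearMap.comp_apply,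
      ceDAlt_ceDAlt br ρ halt hρ hbr, map_zero]
  have h3 := (Submodule.comapSubtypeEquivOfLe hle).finrank_eq
  have h4 : Module.finrank ℝ (ceB br ρ (p + 1)) =
      Module.finrank ℝ (LinearMap.range (ceD br ρ p)) := by
    rw [ceB_succ br ρ halt, ceD_eq_altEval_comp br ρ halt, LinearMap.range_comp]
    exact (Submodule.equivMapOfInjective _ (altEval_injective _) _).finrank_eq
  omega

end Dimension

section Contraction

variable {V : Type} [AddCommGroup V] [Module ℝ V]

/-- The bracket `e⁻¹ [e x, e y]`. -/
def pullbackBr (br : V →ₗ[ℝ] V →ₗ[ℝ] V) (e : V ≃ₗ[ℝ] V) : V →ₗ[ℝ] V →ₗ[ℝ] V :=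
  (br.compl₁₂ e.toLinearMap e.toLinearMap).compr₂ e.symm.toLinearMap

@[simp]
theorem pullbackBr_apply (br : V →ₗ[ℝ] V →ₗ[ℝ] V) (e : V ≃ₗ[ℝ] V) (x y : V) :
    pullbackBr br e x y = e.symm (br (e x) (e y)) := rfl

/-- Transport of an adjoint cochain along an automorphism. -/
def transport (e : V ≃ₗ[ℝ] V) (p : ℕ) : (V [⋀^Fin p]→ₗ[ℝ] V) →ₗ[ℝ] (V [⋀^Fin p]→ₗ[ℝ] V) where
  toFun Φ := e.toLinearMap.compAlternatingMap (Φ.compLinearMap e.symm.toLinearMap)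
  map_add' Φ Ψ := by ext; simp
  map_smul' c Φ := by ext; simp

theorem transport_apply (e : V ≃ₗ[ℝ] V) {p : ℕ} (Φ : V [⋀^Fin p]→ₗ[ℝ] V) (X : Fin p → V) :
    transport e p Φ X = e (Φ fun i => e.symm (X i)) := rfl

theorem ceDfun_pullbackBr (br : V →ₗ[ℝ] V →ₗ[ℝ] V) (e : V ≃ₗ[ℝ] V) {p : ℕ}
    (Φ : V [⋀^Fin p]→ₗ[ℝ] V) (X : Fin (p + 1) → V) :
    ceDfun (pullbackBr br e) (pullbackBr br e) Φ X =
      e.symm (ceDfun br br (transport e p Φ) (e ∘ X)) := by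
  simp only [ceDfun, map_add, map_sum, map_smul, apply_ite e.symm, map_zero, transport_apply,
    pullbackBr_apply, Function.comp_def, e.symm_apply_apply]

variable [FiniteDimensional ℝ V]

/-- Restriction to tuples of basis vectors, as a linear map. -/
noncomputable def basisEval (V : Type) [AddCommGroup V] [Module ℝ V] [FiniteDimensional ℝ V]
    (p : ℕ) : ((Fin p → V) → V) →ₗ[ℝ] ((Fin p → Fin (Module.finrank ℝ V)) → V) :=
  LinearMap.funLeft ℝ V fun v i => Module.finBasis ℝ V (v i)

theorem basisEval_comp_altEval_injective (p : ℕ) :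
    Function.Injective (basisEval V p ∘ₗ (altEval p : (V [⋀^Fin p]→ₗ[ℝ] V) →ₗ[ℝ] _)) := by
  intro Φ Ψ h
  apply AlternatingMap.coe_multilinearMap_injective
  exact Module.Basis.ext_multilinear (fun _ => Module.finBasis ℝ V) fun v => congrFun h v

end Contraction

section Limit

variable {V : Type} [NormedAddCommGroup V] [NormedSpace ℝ V] [FiniteDimensional ℝ V]

theorem tendsto_ceDfun {ι : Type*} {l : Filter ι} {br : ι → V →ₗ[ℝ] V →ₗ[ℝ] V}
    {br' : V →ₗ[ℝ] V →ₗ[ℝ] V} (h : ∀ x y, Tendsto (fun t => br t x y) l (𝓝 (br' x y))) :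
    ∀ {p : ℕ} (Φ : V [⋀^Fin p]→ₗ[ℝ] V) (X : Fin (p + 1) → V),
      Tendsto (fun t => ceDfun (br t) (br t) Φ X) l (𝓝 (ceDfun br' br' Φ X)) := by
  have hL : ∀ {p : ℕ} (Φ : V [⋀^Fin p]→ₗ[ℝ] V) (x : V) (Y : Fin p → V),
      Tendsto (fun t => lieDeriv (br t) (br t) x Φ Y) l (𝓝 (lieDeriv br' br' x Φ Y)) := by
    intro p Φ x Y
    simp only [lieDeriv_apply]
    refine (h _ _).sub (tendsto_finsetSum _ fun i _ => ?_)
    exact ((Φ.toMultilinearMap.toLinearMap Y i).continuous_of_finiteDimensional.tendsto _).comp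
      (h x (Y i))
  intro p
  induction p with
  | zero =>
    intro Φ X
    rw [← Fin.cons_self_tail X]
    simp only [ceDfun_zero]
    exact hL _ _ _
  | succ p ih =>
    intro Φ X
    rw [← Fin.cons_self_tail X]
    simp only [ceDfun_cons]
    exact (hL _ _ _).sub (ih _ _)

theorem finrank_range_ceD_le {μ μ' : LieBracketOn V} (h : Contracts μ μ') (p : ℕ) :
    Module.finrank ℝ (LinearMap.range (ceD μ'.br μ'.br p)) ≤
      Module.finrank ℝ (LinearMap.range (ceD μ.br μ.br p)) := by
  obtain ⟨Φ, hΦ⟩ := h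
  obtain ⟨t, ht⟩ := (eventually_finrank_range_le
    (T := fun t => basisEval V (p + 1) ∘ₗ ceD (pullbackBr μ.br (Φ t)) (pullbackBr μ.br (Φ t)) p)
    (T' := basisEval V (p + 1) ∘ₗ ceD μ'.br μ'.br p) (l := atTop)
    fun c => tendsto_pi_nhds.2 fun v => tendsto_ceDfun hΦ c _).exists
  have hfac : ceD (pullbackBr μ.br (Φ t)) (pullbackBr μ.br (Φ t)) p =
      (((Φ t).symm.toLinearMap.compLeft _) ∘ₗ
        LinearMap.funLeft ℝ V (fun X : Fin (p + 1) → V => Φ t ∘ X)) ∘ₗ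
        ceD μ.br μ.br p ∘ₗ transport (Φ t) p := by
    ext c X
    exact ceDfun_pullbackBr μ.br (Φ t) c X
  have hinj : Module.finrank ℝ (LinearMap.range (basisEval V (p + 1) ∘ₗ ceD μ'.br μ'.br p)) =
      Module.finrank ℝ (LinearMap.range (ceD μ'.br μ'.br p)) := by
    rw [ceD_eq_altEval_comp μ'.br μ'.br μ'.alt, ← LinearMap.comp_assoc,
      LinearMap.range_comp, LinearMap.range_comp _ (altEval (p + 1)),
      ← (Submodule.equivMapOfInjective _ (basisEval_comp_altEval_injective _) _).finrank_eq,
      ← (Submodule.equivMapOfInjective _ (altEval_injective _) _).finrank_eq]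
  rw [← hinj]
  refine ht.trans ((finrank_range_comp_le _ _).trans ?_)
  rw [hfac]
  refine (finrank_range_comp_le _ _).trans ?_
  rw [LinearMap.range_comp]
  exact Submodule.finrank_mono (LinearMap.map_le_range)

end Limit

end CE

theorem LieBracketOn.br_br (μ : LieBracketOn V) (x y z : V) :
    μ.br (μ.br x y) z = μ.br x (μ.br y z) - μ.br y (μ.br x z) := by
  have hskew : ∀ a b, μ.br a b = -μ.br b a := fun a b => by
    have h := μ.alt (a + b)
    simp only [map_add, LinearMap.add_apply, μ.alt, zero_add, add_zero] at h
    rw [add_comm] at h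
    exact eq_neg_of_add_eq_zero_left h
  have h := μ.jacobi x y z
  rw [hskew z x, map_neg, hskew z] at h
  rw [sub_eq_add_neg, ← sub_eq_zero, ← neg_eq_zero, ← h]
  abel

open CE in
/-- If `g = (V,μ)` contracts onto `g' = (V,μ')`, then
`dim H^k(g,g) ≤ dim H^k(g',g')` for every `k ≥ 0` (adjoint coefficients: `ρ = br`). -/
theorem contraction_adjoint_cohomology_dim_le [FiniteDimensional ℝ V]
    (μ μ' : LieBracketOn V) (h : Contracts μ μ') (k : ℕ) :
    Hdim μ.br μ.br k ≤ Hdim μ'.br μ'.br k := by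
  cases k with
  | zero =>
    have h1 := Hdim_zero_add μ.br μ.br
    have h2 := Hdim_zero_add μ'.br μ'.br
    have h3 := finrank_range_ceD_le h 0
    omega
  | succ k =>
    have h1 := Hdim_succ_add μ.br μ.br k μ.alt μ.br_br μ.br_br
    have h2 := Hdim_succ_add μ'.br μ'.br k μ'.alt μ'.br_br μ'.br_br
    have h3 := finrank_range_ceD_le h k
    have h4 := finrank_range_ceD_le h (k + 1)
    omega
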